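/- Let n, d, j, k be integers with 0 ≤ d ≤ n, 0 ≤ k ≤ d, and k ≤ j ≤ n. If k < n − d, then Σ_{i=0}^{n−d} (−1)^{n−d−i} · i · C(i+j−k, j) · C(j+1, n−d−i) = j + 1. -/

import Mathlib

open PowerSeries in
theorem PowerSeries.coeff_one_sub_X_pow {R : Type*} [CommRing R] (e m : ℕ) :
    coeff m ((1 - X : R⟦X⟧) ^ e) = (-1) ^ m * (e.choose m : R) := by
  induction e generalizing m with
  | zero => cases m <;> simp [coeff_one]
  | succ e ih =>
    rw [pow_succ, mul_sub, mul_one, map_sub, ih]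
    cases m with
    | zero => simp
    | succ m =>
      rw [coeff_succ_mul_X, ih, Nat.choose_succ_succ]
      push_cast
      ring

open PowerSeries in
/-- The generating function of `(m + k) * (j + m).choose j`, in terms of `mk 1 = 1 / (1 - X)`. -/
theorem PowerSeries.mk_add_mul_choose {R : Type*} [CommRing R] (j k : ℕ) :
    (mk fun m ↦ ((m : R) + k) * ((j + m).choose j : R)) =
      C (k : R) * (mk 1) ^ (j + 1) + C ((j : R) + 1) * (X * (mk 1) ^ (j + 2)) := by
  rw [mk_one_pow_eq_mk_choose_add, mk_one_pow_eq_mk_choose_add]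
  ext m
  cases m with
  | zero => simp
  | succ m =>
    have h : ((j + (m + 1)).choose (j + 1) : R) * (j + 1)
        = (j + (m + 1)).choose j * (m + 1) := by
      have := Nat.choose_succ_right_eq (j + (m + 1)) j
      rw [Nat.add_sub_cancel_left] at this
      exact_mod_cast congrArg (Nat.cast (R := R)) this
    rw [map_add, coeff_C_mul, coeff_C_mul, coeff_succ_X_mul, coeff_mk, coeff_mk, coeff_mk,
      show j + 1 + m = j + (m + 1) by ring]
    push_cast
    linear_combination -h

open PowerSeries in
theorem sum_range_add_mul_choose_mul_choose {R : Type*} [CommRing R] (j k M : ℕ) :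
    ∑ m ∈ Finset.range (M + 2), ((m : R) + k) * ((j + m).choose j : R) *
        ((-1) ^ (M + 1 - m) * ((j + 1).choose (M + 1 - m) : R)) = j + 1 := by
  have h1 : (mk 1 : R⟦X⟧) ^ (j + 1) * (1 - X) ^ (j + 1) = 1 := by
    rw [← mul_pow, mk_one_mul_one_sub_eq_one, one_pow]
  have h : (mk fun m ↦ ((m : R) + k) * ((j + m).choose j : R)) * (1 - X) ^ (j + 1) =
      C (k : R) + C ((j : R) + 1) * (X * mk 1) := by
    rw [mk_add_mul_choose]
    linear_combination (C (k : R) + C ((j : R) + 1) * X * mk 1) * h1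
  have h2 := congrArg (coeff (M + 1)) h
  rw [coeff_mul, Finset.Nat.sum_antidiagonal_eq_sum_range_succ_mk, map_add, coeff_C_mul,
    coeff_succ_X_mul, coeff_C, if_neg M.succ_ne_zero, coeff_mk] at h2
  simpa [coeff_one_sub_X_pow] using h2


/-- For natural numbers `0 ≤ d ≤ n`, `0 ≤ k ≤ d`, `k ≤ j ≤ n` with
`k < n - d`, one has
`∑_{i=0}^{n-d} (-1)^{n-d-i} · i · C(i+j-k, j) · C(j+1, n-d-i) = j + 1`. -/
theorem key_binomial_identity_small_k (n d j k : ℕ)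
    (hdn : d ≤ n) (hkd : k ≤ d) (hkj : k ≤ j) (hjn : j ≤ n)
    (hk : k < n - d) :
    ∑ i ∈ Finset.range (n - d + 1),
        (-1 : ℤ) ^ (n - d - i) * i * ((i + j - k).choose j) * ((j + 1).choose (n - d - i))
      = (j : ℤ) + 1 := by
  obtain ⟨M, hM⟩ : ∃ M, n - d = k + (M + 1) := ⟨n - d - k - 1, by omega⟩
  rw [hM, show k + (M + 1) + 1 = k + (M + 2) by ring, Finset.sum_range_add,
    Finset.sum_eq_zero, zero_add, ← sum_range_add_mul_choose_mul_choose j k M]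
  · refine Finset.sum_congr rfl fun m _ ↦ ?_
    rw [show k + (M + 1) - (k + m) = M + 1 - m by omega, show k + m + j - k = j + m by omega]
    push_cast
    ring
  · intro i hi
    rw [Finset.mem_range] at hi
    rw [Nat.choose_eq_zero_of_lt (show i + j - k < j by omega)]
    simp
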